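/- Let q ≥ 1 and let ξ ∈ D(v,d,q·1_d) be an exact block design with all blocks of size q satisfying: (i) if q is even then ξ(0,k) = q/2 for every k, and if q is odd then ξ(0,k) ∈ {(q−1)/2, (q+1)/2} for every k; and (ii) μ_{01}(ξ) = μ_{02}(ξ) = … = μ_{0v}(ξ). Then ξ is E-optimal for treatment-control comparisons in D(v,d,q·1_d), i.e., ξ maximizes λ_min(N(η)) over all η ∈ D(v,d,q·1_d). -/

import Mathlib

open Matrix BigOperators Finset

/-- An exact block design in `D(v,d,m)`: `v` test treatments (labelled `1,…,v`, with
treatment `0` the control), `d` blocks of sizes `m_1,…,m_d`; `w i k` is the number of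
trials of treatment `i` in block `k`. -/
structure ExactDesign (v d : ℕ) (m : Fin d → ℕ) where
  w : Fin (v + 1) → Fin d → ℕ
  block_sum : ∀ k, ∑ i, w i k = m k

namespace ExactDesign

variable {v d : ℕ} {m : Fin d → ℕ}

/-- Treatment replications `r_i(ξ)`. -/
def r (ξ : ExactDesign v d m) (i : Fin (v + 1)) : ℕ := ∑ k, ξ.w i k

/-- Concurrences `μ_{ij}(ξ) = Σ_k ξ(i,k) ξ(j,k)`. -/
def mu (ξ : ExactDesign v d m) (i j : Fin (v + 1)) : ℕ := ∑ k, ξ.w i k * ξ.w j k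

/-- The information matrix `N(ξ) = diag(r_1,…,r_v) − Z diag(m⁻¹) Zᵀ` for comparing
the test treatments with the control. -/
noncomputable def N (ξ : ExactDesign v d m) : Matrix (Fin v) (Fin v) ℝ :=
  Matrix.of fun i j =>
    (if i = j then (ξ.r i.succ : ℝ) else 0)
      - ∑ k, (ξ.w i.succ k : ℝ) * (ξ.w j.succ k : ℝ) / (m k : ℝ)

end ExactDesign

/-- The smallest eigenvalue of a real matrix, as the infimum of its spectrum. -/
noncomputable def lamMin {n : ℕ} (A : Matrix (Fin n) (Fin n) ℝ) : ℝ :=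
  sInf (spectrum ℝ A)

/-- The sum of the variances plus the sum of absolute values of the covariances of
the treatment-control contrast estimators: `Σ_i (A⁻¹)_{ii} + Σ_{i ≠ j} |(A⁻¹)_{ij}|`. -/
noncomputable def varCovSum {n : ℕ} (A : Matrix (Fin n) (Fin n) ℝ) : ℝ :=
  ∑ i, A⁻¹ i i + ∑ i, ∑ j, if i = j then 0 else |A⁻¹ i j|

theorem Matrix.IsHermitian.le_lamMin_iff {n : ℕ} [NeZero n] {A : Matrix (Fin n) (Fin n) ℝ}
    (hA : A.IsHermitian) (c : ℝ) :
    c ≤ lamMin A ↔ ∀ x : Fin n → ℝ, c * (x ⬝ᵥ x) ≤ x ⬝ᵥ (A *ᵥ x) := by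
  have hne : (spectrum ℝ A).Nonempty := by
    rw [hA.spectrum_real_eq_range_eigenvalues]
    exact Set.range_nonempty _
  have hherm : (A - algebraMap ℝ (Matrix (Fin n) (Fin n) ℝ) c).IsHermitian := by
    refine hA.sub ?_
    rw [Matrix.algebraMap_eq_diagonal]
    exact Matrix.isHermitian_diagonal _
  have key : (∀ x : Fin n → ℝ, c * (x ⬝ᵥ x) ≤ x ⬝ᵥ (A *ᵥ x)) ↔
      (A - algebraMap ℝ (Matrix (Fin n) (Fin n) ℝ) c).PosSemidef := by
    rw [Matrix.posSemidef_iff_dotProduct_mulVec, and_iff_right hherm]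
    refine forall_congr' fun x => ?_
    rw [Algebra.algebraMap_eq_smul_one, Matrix.sub_mulVec, Matrix.smul_mulVec, Matrix.one_mulVec,
      dotProduct_sub, dotProduct_smul, star_trivial, sub_nonneg, smul_eq_mul]
  rw [key, Matrix.posSemidef_iff_isHermitian_and_spectrum_nonneg, and_iff_right hherm,
    ← spectrum.sub_singleton_eq, lamMin,
    le_csInf_iff (Matrix.finite_spectrum A).bddBelow hne]
  simp [Set.subset_def]

namespace ExactDesign

variable {v d q : ℕ}

theorem isHermitian_N {m : Fin d → ℕ} (ξ : ExactDesign v d m) : ξ.N.IsHermitian := by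
  ext i j
  rcases eq_or_ne i j with rfl | h
  · simp
  · simp [N, h, h.symm, mul_comm]

theorem sum_w_succ (ξ : ExactDesign v d fun _ => q) (k : Fin d) :
    ∑ i : Fin v, (ξ.w i.succ k : ℝ) = q - ξ.w 0 k := by
  have h := ξ.block_sum k
  rw [Fin.sum_univ_succ] at h
  rw [eq_sub_iff_add_eq']
  exact_mod_cast h

/-- The row sums of the information matrix are the scaled concurrences with the control. -/
theorem sum_N_row (hq : 1 ≤ q) (ξ : ExactDesign v d fun _ => q) (i : Fin v) :
    ∑ j, ξ.N i j = (ξ.mu 0 i.succ : ℝ) / q := by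
  have hq' : (q : ℝ) ≠ 0 := by positivity
  simp only [N, Matrix.of_apply, sum_sub_distrib, sum_ite_eq, mem_univ, if_true]
  rw [sum_comm, r, mu]
  push_cast
  rw [← sum_sub_distrib, sum_div]
  refine sum_congr rfl fun k _ => ?_
  rw [← sum_div, ← mul_sum, sum_w_succ]
  field_simp
  ring

theorem N_offDiag_nonpos {m : Fin d → ℕ} (ξ : ExactDesign v d m) {i j : Fin v} (h : i ≠ j) :
    ξ.N i j ≤ 0 := by
  simp only [N, Matrix.of_apply, if_neg h, zero_sub, neg_nonpos]
  positivity

theorem sum_mu_zero (ξ : ExactDesign v d fun _ => q) :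
    ∑ i : Fin v, (ξ.mu 0 i.succ : ℝ) = ∑ k, (ξ.w 0 k : ℝ) * (q - ξ.w 0 k) := by
  simp only [mu]
  push_cast
  rw [sum_comm]
  simp_rw [← mul_sum, sum_w_succ]

end ExactDesign

/-- A symmetric matrix with constant row sum `c` and nonpositive off-diagonal entries dominates
`c` times the identity. -/
theorem mul_dotProduct_le_of_rowSum_eq {n : Type*} [Fintype n] {A : Matrix n n ℝ}
    (hA : A.IsHermitian) {c : ℝ} (hrow : ∀ i, ∑ j, A i j = c)
    (hoff : ∀ i j, i ≠ j → A i j ≤ 0) (x : n → ℝ) :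
    c * (x ⬝ᵥ x) ≤ x ⬝ᵥ (A *ᵥ x) := by
  have hsymm (i j : n) : A j i = A i j := by simpa using hA.apply i j
  have h1 : ∑ i, ∑ j, A i j * x i ^ 2 = c * (x ⬝ᵥ x) := by
    simp_rw [← sum_mul, hrow, ← mul_sum, dotProduct, sq]
  have h2 : ∑ i, ∑ j, A i j * x j ^ 2 = c * (x ⬝ᵥ x) := by
    rw [sum_comm, ← h1]
    simp_rw [hsymm]
  have h3 : ∑ i, ∑ j, A i j * (x i * x j) = x ⬝ᵥ (A *ᵥ x) := by
    simp_rw [dotProduct, mulVec, dotProduct, mul_sum]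
    exact sum_congr rfl fun i _ => sum_congr rfl fun j _ => by ring
  have h4 : ∑ i, ∑ j, A i j * (x i - x j) ^ 2 ≤ 0 := by
    refine sum_nonpos fun i _ => sum_nonpos fun j _ => ?_
    rcases eq_or_ne i j with rfl | h
    · simp
    · exact mul_nonpos_of_nonpos_of_nonneg (hoff i j h) (sq_nonneg _)
  have h5 : ∑ i, ∑ j, A i j * (x i - x j) ^ 2 = ∑ i, ∑ j, A i j * x i ^ 2
      + ∑ i, ∑ j, A i j * x j ^ 2 - 2 * ∑ i, ∑ j, A i j * (x i * x j) := by
    simp_rw [mul_sum, ← sum_add_distrib, ← sum_sub_distrib]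
    exact sum_congr rfl fun i _ => sum_congr rfl fun j _ => by ring
  linarith

/-- The product `a (q - a)` over the integers is largest when `a` is as close as possible to
`q / 2`. -/
theorem mul_sub_le_of_balanced {q a : ℕ} (h : if Even q then 2 * a = q
    else (2 * a + 1 = q ∨ 2 * a = q + 1)) (b : ℕ) :
    (b : ℝ) * (q - b) ≤ a * (q - a) := by
  suffices (b : ℤ) * (q - b) ≤ a * (q - a) by exact_mod_cast this
  split_ifs at h with hq
  · have : (q : ℤ) = 2 * a := by omega
    rw [this]
    nlinarith [sq_nonneg ((a : ℤ) - b)]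
  · have hodd : 1 ≤ ((q : ℤ) - 2 * b) ^ 2 := by
      have : (q : ℤ) - 2 * b ≠ 0 := fun h0 => hq ⟨b, by omega⟩
      have := sq_pos_of_ne_zero this
      omega
    rcases h with h | h
    · have : (q : ℤ) = 2 * a + 1 := by omega
      rw [this] at hodd ⊢
      nlinarith
    · have : (q : ℤ) = 2 * a - 1 := by omega
      rw [this] at hodd ⊢
      nlinarith

/-- (Majumdar–Notz) If `ξ ∈ D(v,d,q·1_d)` satisfies `ξ(0,k) = q/2` for
even `q` (resp. `ξ(0,k) ∈ {(q−1)/2, (q+1)/2}` for odd `q`) for all blocks `k`, and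
`μ_{01}(ξ) = … = μ_{0v}(ξ)`, then `ξ` is E-optimal in `D(v,d,q·1_d)`. -/
theorem MajumdarNotz_Eopt {v d q : ℕ} (hv : 2 ≤ v) (hd : 1 ≤ d) (hq : 1 ≤ q)
    (ξ : ExactDesign v d (fun _ => q))
    (h0 : ∀ k, if Even q then 2 * ξ.w 0 k = q
      else (2 * ξ.w 0 k + 1 = q ∨ 2 * ξ.w 0 k = q + 1))
    (hmu : ∀ i j : Fin v, ξ.mu 0 i.succ = ξ.mu 0 j.succ) :
    ∀ η : ExactDesign v d (fun _ => q),
      lamMin (ExactDesign.N η) ≤ lamMin (ExactDesign.N ξ) := by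
  intro η
  have : NeZero v := ⟨by omega⟩
  have hv0 : (0 : ℝ) < v := by positivity
  set c : ℝ := (ξ.mu 0 (0 : Fin v).succ : ℝ) / q
  have hrow (i : Fin v) : ∑ j, ξ.N i j = c := by
    rw [ξ.sum_N_row hq, hmu i 0]
  have hξ : c ≤ lamMin ξ.N := (IsHermitian.le_lamMin_iff ξ.isHermitian_N c).2
    (mul_dotProduct_le_of_rowSum_eq ξ.isHermitian_N hrow fun _ _ => ξ.N_offDiag_nonpos)
  have hone (ζ : ExactDesign v d fun _ => q) : ∑ i, ∑ j, ζ.N i j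
      = (∑ k, (ζ.w 0 k : ℝ) * (q - ζ.w 0 k)) / q := by
    simp_rw [ζ.sum_N_row hq, ← sum_div, ζ.sum_mu_zero]
  have hη : lamMin η.N * v ≤ ∑ i, ∑ j, η.N i j := by
    simpa [dotProduct, mulVec] using
      (IsHermitian.le_lamMin_iff η.isHermitian_N _).1 le_rfl fun _ => 1
  have hle : ∑ i, ∑ j, η.N i j ≤ ∑ i, ∑ j, ξ.N i j := by
    rw [hone, hone]
    gcongr ?_ / _
    exact sum_le_sum fun k _ => mul_sub_le_of_balanced (h0 k) _
  have hsum : ∑ i, ∑ j, ξ.N i j = c * v := by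
    simp [hrow, mul_comm]
  exact (le_of_mul_le_mul_right (hη.trans (hle.trans_eq hsum)) hv0).trans hξ
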